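/- Let p ∈ (1,∞) and β ∈ (1/2, 1). Let σ(x) = |x|^{−β}, w(x) = |x|^{β(p−1)} for x ≠ 0 (σ(0)=w(0)=1). Then the operator norm of f ↦ S(fσ) from L^p(σ) to L^p(w) is at least c_p (1−β)^{−1}, where c_p > 0 depends only on p and S is the dyadic square function on ℝ. -/

import Mathlib

open MeasureTheory Set Filter
open scoped ENNReal NNReal

noncomputable section

/-- Average of `g` over the interval `[a, b)` (with respect to Lebesgue measure). -/
def avgI (g : ℝ → ℝ) (a b : ℝ) : ℝ := (b - a)⁻¹ * ∫ x in Set.Ico a b, g x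

/-- The dyadic interval `[k·2^{-n}, (k+1)·2^{-n})`. -/
def dyadicI (n k : ℤ) : Set ℝ :=
  Set.Ico ((k : ℝ) * (2:ℝ) ^ (-n)) (((k : ℝ) + 1) * (2:ℝ) ^ (-n))

/-- Average of `g` over the dyadic interval `dyadicI n k`. -/
def avgD (g : ℝ → ℝ) (n k : ℤ) : ℝ :=
  avgI g ((k : ℝ) * (2:ℝ) ^ (-n)) (((k : ℝ) + 1) * (2:ℝ) ^ (-n))

/-- The martingale difference `Δ_Q g` associated with the dyadic interval `Q = dyadicI n k`:
`Δ_Q g = Σ_{R child of Q} ⟨g⟩_R 1_R − ⟨g⟩_Q 1_Q`. -/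
def deltaD (g : ℝ → ℝ) (n k : ℤ) (x : ℝ) : ℝ :=
  (dyadicI (n+1) (2*k)).indicator (fun _ => avgD g (n+1) (2*k)) x
    + (dyadicI (n+1) (2*k+1)).indicator (fun _ => avgD g (n+1) (2*k+1)) x
    - (dyadicI n k).indicator (fun _ => avgD g n k) x

/-- The dyadic square function on `ℝ`. -/
def sqFn (g : ℝ → ℝ) (x : ℝ) : ℝ :=
  Real.sqrt (∑' q : ℤ × ℤ, (deltaD g q.1 q.2 x) ^ 2)

open Classical in
/-- The dyadic square function over `[0,1)`: the sum runs only over dyadic intervals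
contained in `[0,1)`. -/
def sqFn01 (g : ℝ → ℝ) (x : ℝ) : ℝ :=
  Real.sqrt (∑' q : ℤ × ℤ,
    if dyadicI q.1 q.2 ⊆ Set.Ico (0:ℝ) 1 then (deltaD g q.1 q.2 x) ^ 2 else 0)

/-- `‖g‖_{L^p(w)}` (as an extended nonnegative real), `w dx` being the underlying measure. -/
def pNorm (p : ℝ) (g w : ℝ → ℝ) : ℝ≥0∞ :=
  (∫⁻ x : ℝ, ENNReal.ofReal (|g x| ^ p * w x)) ^ (1/p)

/-- `‖g‖_{L^p(w)}` over `[0,1)`. -/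
def pNorm01 (p : ℝ) (g w : ℝ → ℝ) : ℝ≥0∞ :=
  (∫⁻ x in Set.Ico (0:ℝ) 1, ENNReal.ofReal (|g x| ^ p * w x)) ^ (1/p)

/-- The joint `A_p` characteristic `[w,σ]_{A_p}`, the supremum running over all bounded
intervals of `ℝ`. -/
def apChar (p : ℝ) (w σ : ℝ → ℝ) : ℝ≥0∞ :=
  ⨆ (a : ℝ) (b : ℝ) (_ : a < b),
    ENNReal.ofReal (avgI w a b * (avgI σ a b) ^ (p - 1))

/-- The joint `A_p` characteristic `[w,σ]_{A_p}`, the supremum running over all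
subintervals of `[0,1)`. -/
def apChar01 (p : ℝ) (w σ : ℝ → ℝ) : ℝ≥0∞ :=
  ⨆ (a : ℝ) (b : ℝ) (_ : 0 ≤ a) (_ : a < b) (_ : b ≤ 1),
    ENNReal.ofReal (avgI w a b * (avgI σ a b) ^ (p - 1))

/-- The local maximal function `M_{[a,b)} σ (x) = sup { ⟨σ⟩_R : R interval ⊆ [a,b), x ∈ R }`. -/
def maxFn (σ : ℝ → ℝ) (a b x : ℝ) : ℝ≥0∞ :=
  ⨆ (c : ℝ) (e : ℝ) (_ : a ≤ c) (_ : c < e) (_ : e ≤ b) (_ : x ∈ Set.Ico c e),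
    ENNReal.ofReal (avgI σ c e)

/-- The Fujii–Wilson `A_∞` characteristic
`[σ]_{A_∞} = sup_Q (1/σ(Q)) ∫_Q M_Q σ`, the supremum over bounded intervals of `ℝ`. -/
def ainfChar (σ : ℝ → ℝ) : ℝ≥0∞ :=
  ⨆ (a : ℝ) (b : ℝ) (_ : a < b),
    (∫⁻ x in Set.Ico a b, maxFn σ a b x) / ENNReal.ofReal (∫ x in Set.Ico a b, σ x)

/-- A weight on `ℝ`: measurable, a.e. positive, integrable over every bounded interval. -/
def IsWeight (w : ℝ → ℝ) : Prop :=
  Measurable w ∧ (∀ᵐ x : ℝ, 0 < w x) ∧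
    ∀ a b : ℝ, a < b → IntegrableOn w (Set.Ico a b)

/-- A weight on `[0,1)`: measurable, a.e. positive on `[0,1)`, integrable over `[0,1)`. -/
def IsWeight01 (w : ℝ → ℝ) : Prop :=
  Measurable w ∧ (∀ᵐ x : ℝ, x ∈ Set.Ico (0:ℝ) 1 → 0 < w x) ∧
    IntegrableOn w (Set.Ico (0:ℝ) 1)


/-- The truncated power weight `x ↦ x^{-β} 1_{(0,1)}(x)`. -/
def truncPow (β : ℝ) : ℝ → ℝ := (Ioo (0:ℝ) 1).indicator fun x => x ^ (-β)

/-- The average of `g` over the dyadic interval of length `2^{-n}` containing `x`. -/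
def dyadicAvg (g : ℝ → ℝ) (x : ℝ) (n : ℤ) : ℝ := avgD g n ⌊x * (2:ℝ) ^ n⌋

theorem mem_dyadicI_iff {n k : ℤ} {x : ℝ} : x ∈ dyadicI n k ↔ ⌊x * (2:ℝ) ^ n⌋ = k := by
  have h2 : (0:ℝ) < (2:ℝ) ^ n := by positivity
  rw [Int.floor_eq_iff, dyadicI, mem_Ico, zpow_neg, ← div_eq_mul_inv, ← div_eq_mul_inv,
    div_le_iff₀ h2, lt_div_iff₀ h2]

theorem floor_mul_two_zpow_succ (x : ℝ) (n : ℤ) :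
    ⌊x * (2:ℝ) ^ (n + 1)⌋ = 2 * ⌊x * (2:ℝ) ^ n⌋ ∨
      ⌊x * (2:ℝ) ^ (n + 1)⌋ = 2 * ⌊x * (2:ℝ) ^ n⌋ + 1 := by
  have e : x * (2:ℝ) ^ (n + 1) = 2 * (x * (2:ℝ) ^ n) := by
    rw [zpow_add_one₀ two_ne_zero]; ring
  rw [e]
  set y := x * (2:ℝ) ^ n
  have h1 : 2 * ⌊y⌋ ≤ ⌊2 * y⌋ := by
    rw [Int.le_floor]; push_cast; linarith [Int.floor_le y]
  have h2 : ⌊2 * y⌋ < 2 * ⌊y⌋ + 2 := by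
    rw [Int.floor_lt]; push_cast; linarith [Int.lt_floor_add_one y]
  omega

theorem deltaD_floor (g : ℝ → ℝ) (x : ℝ) (n : ℤ) :
    deltaD g n ⌊x * (2:ℝ) ^ n⌋ x = dyadicAvg g x (n + 1) - dyadicAvg g x n := by
  rcases floor_mul_two_zpow_succ x n with h | h <;>
    simp [deltaD, dyadicAvg, indicator, mem_dyadicI_iff, h]

theorem deltaD_eq_zero {g : ℝ → ℝ} {x : ℝ} {n k : ℤ} (h : ⌊x * (2:ℝ) ^ n⌋ ≠ k) :
    deltaD g n k x = 0 := by
  have h1 : ⌊x * (2:ℝ) ^ (n + 1)⌋ ≠ 2 * k ∧ ⌊x * (2:ℝ) ^ (n + 1)⌋ ≠ 2 * k + 1 := by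
    rcases floor_mul_two_zpow_succ x n with h' | h' <;> omega
  simp [deltaD, indicator, mem_dyadicI_iff, h, h1.1, h1.2]

/-- If the squared increments of the dyadic averages at `x` are summable, the square function
dominates each increment. -/
theorem abs_dyadicAvg_sub_le_sqFn {g : ℝ → ℝ} {x : ℝ}
    (hs : Summable fun n : ℤ => (dyadicAvg g x (n + 1) - dyadicAvg g x n) ^ 2) (n : ℤ) :
    |dyadicAvg g x (n + 1) - dyadicAvg g x n| ≤ sqFn g x := by
  have hinj : Function.Injective fun n : ℤ => (n, ⌊x * (2:ℝ) ^ n⌋) :=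
    fun a b h => congrArg Prod.fst h
  have hsum : Summable fun q : ℤ × ℤ => (deltaD g q.1 q.2 x) ^ 2 := by
    refine (hinj.summable_iff ?_).1 (hs.congr fun m => ?_)
    · rintro ⟨m, k⟩ hmk
      have : ⌊x * (2:ℝ) ^ m⌋ ≠ k := fun h => hmk ⟨m, by simp [h]⟩
      simp [deltaD_eq_zero this]
    · simp [deltaD_floor]
  rw [← Real.sqrt_sq_eq_abs, sqFn, ← deltaD_floor]
  exact Real.sqrt_le_sqrt
    (hsum.le_tsum (n, ⌊x * (2:ℝ) ^ n⌋) fun _ _ => sq_nonneg _)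

theorem integrableOn_rpow_neg {β : ℝ} (hβ : β < 1) :
    IntegrableOn (fun x : ℝ => x ^ (-β)) (Ioo 0 1) :=
  (intervalIntegral.integrableOn_Ioo_rpow_iff one_pos).2 (by linarith)

theorem integrable_truncPow {β : ℝ} (hβ : β < 1) : Integrable (truncPow β) :=
  (integrable_indicator_iff measurableSet_Ioo).2 (integrableOn_rpow_neg hβ)

theorem avgI_truncPow_mem_Icc {β a b : ℝ} (h0 : 0 < β) (h1 : β < 1) (ha : 0 < a) (hab : a < b)
    (hb : b ≤ 1) : avgI (truncPow β) a b ∈ Icc (b ^ (-β)) (a ^ (-β)) := by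
  have hba : 0 < b - a := sub_pos.2 hab
  have hval : ∀ x ∈ Ico a b, truncPow β x = x ^ (-β) := fun x hx =>
    indicator_of_mem (s := Ioo (0:ℝ) 1) ⟨ha.trans_le hx.1, hx.2.trans_le hb⟩ _
  have hconst : ∀ c : ℝ, ∫ _ in Ico a b, c = (b - a) * c := fun c => by
    simp [hab.le]
  have hi : IntegrableOn (truncPow β) (Ico a b) := (integrable_truncPow h1).integrableOn
  have hc : ∀ c : ℝ, IntegrableOn (fun _ : ℝ => c) (Ico a b) := fun c =>
    integrableOn_const (by simp)
  rw [avgI, mem_Icc, inv_mul_eq_div, le_div_iff₀' hba, div_le_iff₀' hba, ← hconst, ← hconst]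
  refine ⟨setIntegral_mono_on (hc _) hi measurableSet_Ico fun x hx => ?_,
    setIntegral_mono_on hi (hc _) measurableSet_Ico fun x hx => ?_⟩
  · rw [hval x hx]
    exact Real.rpow_le_rpow_of_nonpos (ha.trans_le hx.1) hx.2.le (by linarith)
  · rw [hval x hx]
    exact Real.rpow_le_rpow_of_nonpos ha hx.1 (by linarith)

theorem avgI_truncPow_zero {β h : ℝ} (h1 : β < 1) (hh : 0 < h) (hh1 : h ≤ 1) :
    avgI (truncPow β) 0 h = h ^ (-β) / (1 - β) := by
  have e : ∫ x in Ico 0 h, truncPow β x = ∫ x in (0:ℝ)..h, x ^ (-β) := by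
    rw [integral_Ico_eq_integral_Ioo, intervalIntegral.integral_of_le hh.le,
      integral_Ioc_eq_integral_Ioo]
    refine setIntegral_congr_fun measurableSet_Ioo fun x hx => ?_
    exact indicator_of_mem (s := Ioo (0:ℝ) 1) ⟨hx.1, hx.2.trans_le hh1⟩ _
  rw [avgI, e, integral_rpow (Or.inl (by linarith)), Real.zero_rpow (by linarith), sub_zero,
    sub_zero, Real.rpow_add_one hh.ne', neg_add_eq_sub]
  field_simp

/-- A power function with exponent in `(-1,0)` oscillates at most linearly in the length. -/
theorem rpow_neg_sub_rpow_neg_le {β a b : ℝ} (h1 : β < 1) (ha : 0 < a) (hab : a ≤ b) :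
    a ^ (-β) - b ^ (-β) ≤ a ^ (-β) * ((b - a) / b) := by
  have hb : 0 < b := ha.trans_le hab
  have h : a / b ≤ (a / b) ^ β :=
    Real.self_le_rpow_of_le_one (by positivity) ((div_le_one hb).2 hab) h1.le
  have e : b ^ (-β) = a ^ (-β) * (a / b) ^ β := by
    rw [Real.div_rpow ha.le hb.le, Real.rpow_neg ha.le, Real.rpow_neg hb.le]
    have := (Real.rpow_pos_of_pos ha β).ne'
    field_simp
  have e' : (b - a) / b = 1 - a / b := by field_simp
  rw [e, e']
  nlinarith [Real.rpow_pos_of_pos ha (-β)]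

theorem abs_dyadicAvg_truncPow_sub_le {β x : ℝ} (h0 : 0 < β) (h1 : β < 1) (hx : x ∈ Ioo (0:ℝ) 1)
    {n : ℕ} (hn : (2:ℝ)⁻¹ ^ n ≤ x / 2) :
    |dyadicAvg (truncPow β) x n - x ^ (-β)| ≤ ((x / 2) ^ (-β) / x) * (2:ℝ)⁻¹ ^ n := by
  obtain ⟨hx0, hx1⟩ := hx
  set k := ⌊x * (2:ℝ) ^ (n:ℤ)⌋ with hk
  have hmem : x ∈ dyadicI n k := mem_dyadicI_iff.2 rfl
  have hz : (2:ℝ) ^ (-(n:ℤ)) = (2:ℝ)⁻¹ ^ n := by simp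
  have hpos : (0:ℝ) < (2:ℝ)⁻¹ ^ n := by positivity
  have hk1 : ((k:ℝ) + 1) * (2:ℝ)⁻¹ ^ n ≤ 1 := by
    have : k < 2 ^ n := by
      rw [hk, Int.floor_lt]; push_cast; rw [zpow_natCast]
      nlinarith [show (0:ℝ) < 2 ^ n by positivity]
    have h' : (k:ℝ) + 1 ≤ 2 ^ n := by exact_mod_cast this
    calc ((k:ℝ) + 1) * (2:ℝ)⁻¹ ^ n ≤ 2 ^ n * (2:ℝ)⁻¹ ^ n := by gcongr
      _ = 1 := by rw [← mul_pow]; norm_num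
  rw [dyadicI, hz, mem_Ico] at hmem
  have hA : dyadicAvg (truncPow β) x n
      = avgI (truncPow β) (k * (2:ℝ)⁻¹ ^ n) ((k + 1) * (2:ℝ)⁻¹ ^ n) := by
    rw [dyadicAvg, avgD, hz]
  have hlen : ((k:ℝ) + 1) * (2:ℝ)⁻¹ ^ n - k * (2:ℝ)⁻¹ ^ n = (2:ℝ)⁻¹ ^ n := by ring
  set a := (k:ℝ) * (2:ℝ)⁻¹ ^ n
  set b := ((k:ℝ) + 1) * (2:ℝ)⁻¹ ^ n
  have hxa : x / 2 ≤ a := by linarith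
  have ha : 0 < a := by linarith
  obtain ⟨hl, hu⟩ := avgI_truncPow_mem_Icc h0 h1 ha (by linarith : a < b) hk1
  have hxl : b ^ (-β) ≤ x ^ (-β) :=
    Real.rpow_le_rpow_of_nonpos hx0 hmem.2.le (by linarith)
  have hxu : x ^ (-β) ≤ a ^ (-β) := Real.rpow_le_rpow_of_nonpos ha hmem.1 (by linarith)
  have hosc := rpow_neg_sub_rpow_neg_le h1 ha (by linarith : a ≤ b)
  have haa : a ^ (-β) ≤ (x / 2) ^ (-β) :=
    Real.rpow_le_rpow_of_nonpos (by linarith) hxa (by linarith)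
  have hlast : a ^ (-β) * ((b - a) / b) ≤ ((x / 2) ^ (-β) / x) * (2:ℝ)⁻¹ ^ n := by
    rw [hlen, div_mul_eq_mul_div, ← mul_div_assoc]
    gcongr
    exact hmem.2.le
  rw [hA, abs_le]
  constructor <;> linarith

theorem summable_sq_sub_succ {u : ℕ → ℝ} (c : ℝ) (h : Summable fun n => (u n - c) ^ 2) :
    Summable fun n => (u (n + 1) - u n) ^ 2 := by
  refine Summable.of_nonneg_of_le (fun _ => sq_nonneg _) (fun n => ?_)
    ((((summable_nat_add_iff 1).2 h).add h).mul_left 2)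
  nlinarith [sq_nonneg ((u (n + 1) - c) + (u n - c))]

theorem abs_dyadicAvg_neg_le {g : ℝ → ℝ} (hg : Integrable g) {x : ℝ} (hx : x ∈ Ioo (0:ℝ) 1)
    (n : ℕ) : |dyadicAvg g x (-(n:ℤ))| ≤ (2:ℝ)⁻¹ ^ n * ∫ y, |g y| := by
  have hk : ⌊x * (2:ℝ) ^ (-(n:ℤ))⌋ = 0 := by
    rw [Int.floor_eq_zero_iff, zpow_neg, zpow_natCast, ← inv_pow]
    have h1 : (2:ℝ)⁻¹ ^ n ≤ 1 := pow_le_one₀ (by norm_num) (by norm_num)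
    have h0 : 0 < (2:ℝ)⁻¹ ^ n := by positivity
    exact ⟨by nlinarith [hx.1], by nlinarith [hx.1, hx.2]⟩
  rw [dyadicAvg, hk, avgD, avgI, abs_mul]
  have e : |(((0:ℤ):ℝ) + 1) * (2:ℝ) ^ (-(-(n:ℤ))) - ((0:ℤ):ℝ) * (2:ℝ) ^ (-(-(n:ℤ)))|⁻¹
      = (2:ℝ)⁻¹ ^ n := by
    simp
  rw [abs_inv, e]
  gcongr
  exact (abs_integral_le_integral_abs).trans
    (setIntegral_le_integral hg.abs (Eventually.of_forall fun _ => abs_nonneg _))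

theorem summable_sq_dyadicAvg_truncPow_sub {β x : ℝ} (h0 : 0 < β) (h1 : β < 1)
    (hx : x ∈ Ioo (0:ℝ) 1) :
    Summable fun n : ℤ =>
      (dyadicAvg (truncPow β) x (n + 1) - dyadicAvg (truncPow β) x n) ^ 2 := by
  have hgeo : ∀ K : ℝ, Summable fun n : ℕ => (K * (2:ℝ)⁻¹ ^ n) ^ 2 := fun K => by
    simp_rw [mul_pow, ← pow_mul, mul_comm _ 2, pow_mul]
    exact (summable_geometric_of_lt_one (by norm_num) (by norm_num)).mul_left _
  refine Summable.of_nat_of_neg ?_ ?_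
  · refine summable_sq_sub_succ (u := fun n : ℕ => dyadicAvg (truncPow β) x n) (x ^ (-β)) ?_
    refine Summable.of_norm_bounded_eventually_nat (hgeo ((x / 2) ^ (-β) / x)) ?_
    have ht : Tendsto (fun n : ℕ => (2:ℝ)⁻¹ ^ n) atTop (nhds 0) :=
      tendsto_pow_atTop_nhds_zero_of_lt_one (by norm_num) (by norm_num)
    filter_upwards [ht.eventually_le_const (half_pos hx.1)] with n hn
    rw [norm_pow, Real.norm_eq_abs]
    exact pow_le_pow_left₀ (abs_nonneg _) (abs_dyadicAvg_truncPow_sub_le h0 h1 hx hn) 2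
  · have hs : Summable fun n : ℕ => (dyadicAvg (truncPow β) x (-(n:ℤ)) - 0) ^ 2 := by
      refine Summable.of_nonneg_of_le (fun _ => sq_nonneg _) (fun n => ?_)
        (hgeo (∫ y, |truncPow β y|))
      rw [sub_zero, ← sq_abs, mul_comm (∫ y, |truncPow β y|)]
      exact pow_le_pow_left₀ (abs_nonneg _)
        (abs_dyadicAvg_neg_le (integrable_truncPow h1) hx n) 2
    refine (summable_nat_add_iff 1).1 ((summable_sq_sub_succ 0 hs).congr fun n => ?_)
    have : -((n + 1 : ℕ):ℤ) + 1 = -(n:ℤ) := by push_cast; ring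
    rw [this]
    ring

/-- Pointwise lower bound for the square function of the truncated power weight. -/
theorem le_sqFn_truncPow {β x : ℝ} (hβ : β ∈ Ioo (1/2 : ℝ) 1) (hx : x ∈ Ioo (0:ℝ) 1) :
    1 / 8 * (1 - β)⁻¹ * x ^ (-β) ≤ sqFn (truncPow β) x := by
  obtain ⟨hβ0, hβ1⟩ := hβ
  obtain ⟨m, hm1, hm2⟩ := exists_mem_Ico_zpow hx.1 (one_lt_two (α := ℝ))
  have hm : m + 1 ≤ 0 := by
    by_contra! h
    have : (1:ℝ) ≤ 2 ^ m := one_le_zpow₀ one_le_two (by omega)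
    linarith [hx.2]
  have hdouble : (2:ℝ) ^ (m + 1) = 2 * 2 ^ m := by rw [zpow_add_one₀ two_ne_zero]; ring
  have hle : (2:ℝ) ^ (m + 1) ≤ 1 := zpow_le_one_of_nonpos₀ one_le_two hm
  have hparent : ⌊x * (2:ℝ) ^ (-(m + 1))⌋ = 0 :=
    mem_dyadicI_iff.1 (by simpa [dyadicI] using And.intro hx.1.le hm2)
  have hchild : ⌊x * (2:ℝ) ^ (-m)⌋ = 1 :=
    mem_dyadicI_iff.1 ⟨by simpa using hm1, by simpa [hdouble, one_add_one_eq_two] using hm2⟩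
  have key := abs_dyadicAvg_sub_le_sqFn
    (summable_sq_dyadicAvg_truncPow_sub (by linarith) hβ1 hx) (-(m + 1))
  have hm0 : (0:ℝ) < 2 ^ m := by positivity
  rw [show -(m + 1) + 1 = -m by ring, dyadicAvg, dyadicAvg, hparent, hchild, avgD, avgD, neg_neg,
    neg_neg, hdouble] at key
  rw [hdouble] at hm2 hle
  simp only [Int.cast_zero, Int.cast_one, zero_mul, zero_add, one_mul, one_add_one_eq_two] at key
  rw [avgI_truncPow_zero hβ1 (by positivity) hle] at key
  obtain ⟨-, hu⟩ := avgI_truncPow_mem_Icc (by linarith : 0 < β) hβ1 hm0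
    (by linarith : (2:ℝ) ^ m < 2 * 2 ^ m) hle
  have hxu : x ^ (-β) ≤ ((2:ℝ) ^ m) ^ (-β) :=
    Real.rpow_le_rpow_of_nonpos hm0 hm1 (by linarith)
  have hscale : ((2:ℝ) ^ m) ^ (-β) = 2 ^ β * (2 * 2 ^ m) ^ (-β) := by
    rw [Real.mul_rpow two_pos.le hm0.le, ← mul_assoc, ← Real.rpow_add two_pos]
    simp
  have hbern : (2:ℝ) ^ β ≤ 1 + β := by
    have := rpow_one_add_le_one_add_mul_self (by norm_num : (-1:ℝ) ≤ 1)
      (by linarith : 0 ≤ β) hβ1.le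
    rwa [one_add_one_eq_two, mul_one] at this
  have hpos : 0 < (2 * (2:ℝ) ^ m) ^ (-β) := by positivity
  rw [hscale] at hu hxu
  set t := (2 * (2:ℝ) ^ m) ^ (-β)
  have hβ : 0 < 1 - β := by linarith
  have hu' : avgI (truncPow β) (2 ^ m) (2 * 2 ^ m) ≤ (1 + β) * t :=
    hu.trans (by gcongr)
  have hxu' : x ^ (-β) ≤ 2 * t := hxu.trans (by gcongr; linarith)
  calc 1 / 8 * (1 - β)⁻¹ * x ^ (-β) ≤ 1 / 8 * (1 - β)⁻¹ * (2 * t) := by gcongr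
    _ ≤ t / (1 - β) - (1 + β) * t := by
      rw [le_sub_iff_add_le, le_div_iff₀ hβ]
      have : (1 / 8 * (1 - β)⁻¹ * (2 * t) + (1 + β) * t) * (1 - β)
          = t * (1 / 4 + (1 - β ^ 2)) := by
        field_simp
        ring
      rw [this]
      exact mul_le_of_le_one_right hpos.le (by nlinarith)
    _ ≤ t / (1 - β) - avgI (truncPow β) (2 ^ m) (2 * 2 ^ m) := by linarith
    _ ≤ sqFn (truncPow β) x := by
      linarith [neg_abs_le (avgI (truncPow β) (2 ^ m) (2 * 2 ^ m) - t / (1 - β))]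

theorem lintegral_rpow_neg_ne_top {β : ℝ} (hβ : β < 1) :
    ∫⁻ x in Ioo (0:ℝ) 1, ENNReal.ofReal (x ^ (-β)) ≠ ∞ :=
  (integrableOn_rpow_neg hβ).lintegral_lt_top.ne

theorem lintegral_rpow_neg_ne_zero (β : ℝ) :
    ∫⁻ x in Ioo (0:ℝ) 1, ENNReal.ofReal (x ^ (-β)) ≠ 0 := by
  refine (setLIntegral_pos_iff (by fun_prop)).2 ?_ |>.ne'
  refine lt_of_lt_of_le (by simp : (0:ℝ≥0∞) < volume (Ioo (0:ℝ) 1)) (measure_mono fun x hx => ?_)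
  refine ⟨?_, hx⟩
  simpa [Function.mem_support] using Real.rpow_pos_of_pos hx.1 (-β)

/-- For `p ∈ (1,∞)`, `β ∈ (1/2,1)`, `σ(x) = |x|^{-β}`,
`w(x) = |x|^{β(p-1)}` (with `σ(0) = w(0) = 1`), the operator norm of
`f ↦ S(fσ) : L^p(σ) → L^p(w)` is at least `c_p (1-β)^{-1}` with `c_p > 0`
depending only on `p`, `S` being the dyadic square function on `ℝ`. -/
theorem statement7 (p : ℝ) (hp : 1 < p) :
    ∃ c > (0:ℝ), ∀ β ∈ Set.Ioo (1/2 : ℝ) 1, ∀ C : ℝ≥0∞,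
      (∀ f : ℝ → ℝ, Measurable f →
        pNorm p (sqFn (fun x => f x * (if x = 0 then 1 else |x| ^ (-β))))
            (fun x => if x = 0 then 1 else |x| ^ (β * (p - 1))) ≤
          C * pNorm p f (fun x => if x = 0 then 1 else |x| ^ (-β))) →
      ENNReal.ofReal (c * (1 - β)⁻¹) ≤ C := by
  refine ⟨1 / 8, by norm_num, fun β hβ C hC => ?_⟩
  have hp0 : 0 < p := by linarith
  have hβ' : 0 < 1 - β := sub_pos.2 hβ.2
  have hfun : (fun x : ℝ => (Ioo (0:ℝ) 1).indicator 1 x * (if x = 0 then 1 else |x| ^ (-β)))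
      = truncPow β := by
    funext x
    by_cases hx : x ∈ Ioo (0:ℝ) 1
    · simp [truncPow, hx, hx.1.ne', abs_of_pos hx.1]
    · simp [truncPow, hx]
  have h := hC ((Ioo (0:ℝ) 1).indicator 1) (measurable_one.indicator measurableSet_Ioo)
  rw [hfun, pNorm, pNorm] at h
  set J := ∫⁻ x in Ioo (0:ℝ) 1, ENNReal.ofReal (x ^ (-β)) with hJ
  have hnorm : ∫⁻ x : ℝ, ENNReal.ofReal
      (|(Ioo (0:ℝ) 1).indicator 1 x| ^ p * (if x = 0 then 1 else |x| ^ (-β))) = J := by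
    rw [hJ, ← lintegral_indicator measurableSet_Ioo]
    refine lintegral_congr fun x => ?_
    by_cases hx : x ∈ Ioo (0:ℝ) 1
    · simp [hx, hx.1.ne', abs_of_pos hx.1]
    · simp [hx, Real.zero_rpow hp0.ne']
  set A := 1 / 8 * (1 - β)⁻¹
  have hA : 0 ≤ A := by positivity
  have hlower : ENNReal.ofReal A ^ p * J ≤ ∫⁻ x : ℝ, ENNReal.ofReal
      (|sqFn (truncPow β) x| ^ p * (if x = 0 then 1 else |x| ^ (β * (p - 1)))) := by
    rw [hJ, ← lintegral_const_mul _ (by fun_prop)]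
    refine le_trans (setLIntegral_mono' measurableSet_Ioo fun x hx => ?_)
      (setLIntegral_le_lintegral (Ioo (0:ℝ) 1) _)
    rw [ENNReal.ofReal_rpow_of_nonneg hA hp0.le, ← ENNReal.ofReal_mul (by positivity),
      if_neg hx.1.ne', abs_of_pos hx.1]
    refine ENNReal.ofReal_le_ofReal ?_
    have hx0 := hx.1
    have hS : A * x ^ (-β) ≤ |sqFn (truncPow β) x| :=
      (le_sqFn_truncPow hβ hx).trans (le_abs_self _)
    calc A ^ p * x ^ (-β) = (A * x ^ (-β)) ^ p * x ^ (β * (p - 1)) := by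
          rw [Real.mul_rpow hA (by positivity), ← Real.rpow_mul hx0.le, mul_assoc,
            ← Real.rpow_add hx0]
          ring_nf
      _ ≤ |sqFn (truncPow β) x| ^ p * x ^ (β * (p - 1)) := by gcongr
  rw [hnorm] at h
  have h' := (ENNReal.rpow_le_rpow hlower (by positivity : 0 ≤ 1 / p)).trans h
  rw [ENNReal.mul_rpow_of_nonneg _ _ (by positivity), ← ENNReal.rpow_mul,
    mul_one_div_cancel hp0.ne', ENNReal.rpow_one] at h'
  exact (ENNReal.mul_le_mul_iff_left
    (by simp [ENNReal.rpow_eq_zero_iff, lintegral_rpow_neg_ne_zero, lintegral_rpow_neg_ne_top hβ.2])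
    (ENNReal.rpow_ne_top_of_nonneg (by positivity) (lintegral_rpow_neg_ne_top hβ.2))).1 h'

end
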